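/- Let T ∈ (0, ∞], and let u : ℝ × ℝ → ℝ be smooth, spatially periodic, and satisfy the μDP equation μ(u_t)(t) − u_txx + 3μ(u)(t) u_x − 3u_x u_xx − u u_xxx = 0 for all (t,x) with 0 ≤ t < T. Assume the initial datum u₀ = u(0,·) has zero mean, ∫₀¹ u₀(x) dx = 0, and is not constant. Then M := min over x ∈ [0,1] of u_x(0,x) is strictly negative, and T ≤ −1/M. In particular, smooth spatially periodic solutions of μDP with nonconstant zero-mean initial data break down in finite time. -/

import Mathlib

open intervalIntegral

/-- Partial derivative in the second (spatial) variable. -/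
noncomputable def pdx (u : ℝ × ℝ → ℝ) : ℝ × ℝ → ℝ := fun p => deriv (fun y => u (p.1, y)) p.2

/-- Partial derivative in the first (time) variable. -/
noncomputable def pdt (u : ℝ × ℝ → ℝ) : ℝ × ℝ → ℝ := fun p => deriv (fun s => u (s, p.2)) p.1

/-- The spatial mean `μ(u)(t) = ∫₀¹ u(t,x) dx`. -/
noncomputable def muMean (u : ℝ × ℝ → ℝ) (t : ℝ) : ℝ := ∫ x in (0:ℝ)..1, u (t, x)

open Set MeasureTheory Filter Topology

theorem eq_zero_of_hasDerivAt_mul_self {a h : ℝ → ℝ} {b : ℝ} (ha : Continuous a)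
    (hh : Continuous h) (hd : ∀ t ∈ Ico 0 b, HasDerivAt h (a t * h t) t) (h0 : h 0 = 0) :
    ∀ t ∈ Icc 0 b, h t = 0 := by
  obtain ⟨K, hK⟩ := (isCompact_Icc (a := (0 : ℝ)) (b := b)).exists_bound_of_continuousOn
    ha.continuousOn
  refine eq_zero_of_abs_deriv_le_mul_abs_self_of_eq_zero_right (K := K) hh.continuousOn
    (fun t ht => (hd t ht).hasDerivWithinAt) h0 fun t ht => ?_
  rw [norm_mul]
  exact mul_le_mul_of_nonneg_right (hK t (Ico_subset_Icc_self ht)) (norm_nonneg _)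

theorem slope_eq_zero_of_hasDerivAt_const {f : ℝ → ℝ} {c : ℝ} (hf : ∀ x, HasDerivAt f c x)
    (h01 : f 1 = f 0) : c = 0 := by
  obtain ⟨x, -, hx⟩ := exists_hasDerivAt_eq_slope f (fun _ => c) zero_lt_one
    (fun x _ => (hf x).continuousAt.continuousWithinAt) fun x _ => hf x
  simpa [h01] using hx

theorem eq_of_hasDerivAt_zero {f : ℝ → ℝ} (hf : ∀ x, HasDerivAt f 0 x) (x y : ℝ) : f x = f y :=
  is_const_of_deriv_eq_zero (fun x => (hf x).differentiableAt) (fun x => (hf x).deriv) x y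

section PartialDerivatives

variable {u : ℝ × ℝ → ℝ}

theorem hasDerivAt_comp_curve (hu : ContDiff ℝ (⊤ : ℕ∞) u) {f g : ℝ → ℝ} {f' g' s : ℝ}
    (hf : HasDerivAt f f' s) (hg : HasDerivAt g g' s) :
    HasDerivAt (fun r => u (f r, g r)) (fderiv ℝ u (f s, g s) (f', g')) s :=
  ((hu.differentiable (by simp)) (f s, g s)).hasFDerivAt.comp_hasDerivAt s (hf.prodMk hg)

theorem pdx_eq_fderiv (hu : ContDiff ℝ (⊤ : ℕ∞) u) : pdx u = fun p => fderiv ℝ u p (0, 1) :=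
  funext fun p => (hasDerivAt_comp_curve hu (hasDerivAt_const p.2 p.1) (hasDerivAt_id p.2)).deriv

theorem pdt_eq_fderiv (hu : ContDiff ℝ (⊤ : ℕ∞) u) : pdt u = fun p => fderiv ℝ u p (1, 0) :=
  funext fun p => (hasDerivAt_comp_curve hu (hasDerivAt_id p.1) (hasDerivAt_const p.1 p.2)).deriv

theorem contDiff_pdx (hu : ContDiff ℝ (⊤ : ℕ∞) u) : ContDiff ℝ (⊤ : ℕ∞) (pdx u) := by
  rw [pdx_eq_fderiv hu]
  exact (hu.fderiv_right (m := (⊤ : ℕ∞)) (by simp)).clm_apply contDiff_const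

theorem contDiff_pdt (hu : ContDiff ℝ (⊤ : ℕ∞) u) : ContDiff ℝ (⊤ : ℕ∞) (pdt u) := by
  rw [pdt_eq_fderiv hu]
  exact (hu.fderiv_right (m := (⊤ : ℕ∞)) (by simp)).clm_apply contDiff_const

theorem hasDerivAt_pdx (hu : ContDiff ℝ (⊤ : ℕ∞) u) (t x : ℝ) :
    HasDerivAt (fun y => u (t, y)) (pdx u (t, x)) x :=
  (hasDerivAt_comp_curve hu (hasDerivAt_const x t) (hasDerivAt_id x)).differentiableAt.hasDerivAt

theorem hasDerivAt_pdt (hu : ContDiff ℝ (⊤ : ℕ∞) u) (t x : ℝ) :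
    HasDerivAt (fun s => u (s, x)) (pdt u (t, x)) t :=
  (hasDerivAt_comp_curve hu (hasDerivAt_id t) (hasDerivAt_const t x)).differentiableAt.hasDerivAt

theorem hasDerivAt_along_line (hu : ContDiff ℝ (⊤ : ℕ∞) u) (x c t : ℝ) :
    HasDerivAt (fun s => u (s, x + s * c))
      (pdt u (t, x + t * c) + c * pdx u (t, x + t * c)) t := by
  have hg : HasDerivAt (fun s => x + s * c) c t := by
    simpa using ((hasDerivAt_id t).mul_const c).const_add x
  refine (hasDerivAt_comp_curve hu (hasDerivAt_id t) hg).congr_deriv ?_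
  have h : ((1 : ℝ), c) = (1, 0) + c • (0, 1) := by simp
  rw [pdt_eq_fderiv hu, pdx_eq_fderiv hu, h, map_add, map_smul]
  rfl

theorem pdt_pdx_comm (hu : ContDiff ℝ (⊤ : ℕ∞) u) : pdt (pdx u) = pdx (pdt u) := by
  have hsnd : Differentiable ℝ (fderiv ℝ u) :=
    (hu.fderiv_right (m := (⊤ : ℕ∞)) (by simp)).differentiable (by simp)
  have happly (p v w : ℝ × ℝ) :
      fderiv ℝ (fun q => fderiv ℝ u q v) p w = fderiv ℝ (fderiv ℝ u) p w v := by
    simp [fderiv_clm_apply (hsnd p) (differentiableAt_const v)]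
  funext p
  rw [pdt_eq_fderiv (contDiff_pdx hu), pdx_eq_fderiv (contDiff_pdt hu), pdx_eq_fderiv hu,
    pdt_eq_fderiv hu]
  simp only [happly]
  exact (hu.contDiffAt.isSymmSndFDerivAt
    (by simpa using WithTop.coe_le_coe.2 (le_top (a := (2 : ℕ∞))))).eq _ _

theorem pdx_periodic (hper : ∀ t x, u (t, x + 1) = u (t, x)) (t x : ℝ) :
    pdx u (t, x + 1) = pdx u (t, x) := by
  simp only [pdx]
  rw [← deriv_comp_add_const]
  simp only [hper]

theorem pdt_periodic (hper : ∀ t x, u (t, x + 1) = u (t, x)) (t x : ℝ) :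
    pdt u (t, x + 1) = pdt u (t, x) := by
  simp only [pdt, hper]

theorem hasDerivAt_muMean (hu : ContDiff ℝ (⊤ : ℕ∞) u) (t : ℝ) :
    HasDerivAt (muMean u) (muMean (pdt u) t) t := by
  have hcu (s : ℝ) : Continuous fun x => u (s, x) :=
    hu.continuous.comp (Continuous.prodMk_right s)
  have hcut (s : ℝ) : Continuous fun x => pdt u (s, x) :=
    (contDiff_pdt hu).continuous.comp (Continuous.prodMk_right s)
  obtain ⟨C, hC⟩ := ((isCompact_closedBall t 1).prod
    (isCompact_Icc (a := (0 : ℝ)) (b := 1))).exists_bound_of_continuousOn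
    (contDiff_pdt hu).continuous.continuousOn
  refine (intervalIntegral.hasDerivAt_integral_of_dominated_loc_of_deriv_le
    (bound := fun _ => C) (F' := fun s x => pdt u (s, x))
    (Metric.closedBall_mem_nhds t one_pos)
    (Eventually.of_forall fun s => (hcu s).aestronglyMeasurable)
    ((hcu t).intervalIntegrable 0 1) (hcut t).aestronglyMeasurable
    (Eventually.of_forall fun x hx s hs => hC (s, x) ⟨hs, ?_⟩)
    intervalIntegrable_const
    (Eventually.of_forall fun x _ s _ => hasDerivAt_pdt hu s x)).2
  rw [uIoc_of_le zero_le_one] at hx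
  exact Ioc_subset_Icc_self hx

end PartialDerivatives

section MuDP

variable {u : ℝ × ℝ → ℝ}

/-- The left-hand side of the μDP equation. -/
noncomputable def muDP (u : ℝ × ℝ → ℝ) (t x : ℝ) : ℝ :=
  muMean (pdt u) t - pdx (pdx (pdt u)) (t, x) + 3 * muMean u t * pdx u (t, x)
    - 3 * pdx u (t, x) * pdx (pdx u) (t, x) - u (t, x) * pdx (pdx (pdx u)) (t, x)

theorem muMean_pdt_eq_zero (hu : ContDiff ℝ (⊤ : ℕ∞) u)
    (hper : ∀ t x, u (t, x + 1) = u (t, x)) {t : ℝ} (heq : ∀ x, muDP u t x = 0) :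
    muMean (pdt u) t = 0 := by
  have h1 := contDiff_pdx hu
  have hflux (x : ℝ) : HasDerivAt (fun y => pdx (pdt u) (t, y) - 3 * muMean u t * u (t, y)
      + pdx u (t, y) ^ 2 + u (t, y) * pdx (pdx u) (t, y)) (muMean (pdt u) t) x := by
    have d0 := hasDerivAt_pdx hu t x
    have d1 := hasDerivAt_pdx h1 t x
    have d2 := hasDerivAt_pdx (contDiff_pdx h1) t x
    have dt1 := hasDerivAt_pdx (contDiff_pdx (contDiff_pdt hu)) t x
    have he := heq x
    unfold muDP at he
    refine (((dt1.sub (d0.const_mul (3 * muMean u t))).add (d1.pow 2)).add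
      (d0.mul d2)).congr_deriv ?_
    push_cast
    linear_combination -he
  refine slope_eq_zero_of_hasDerivAt_const hflux ?_
  have e0 := hper t 0
  have e1 := pdx_periodic hper t 0
  have e2 := pdx_periodic (pdx_periodic hper) t 0
  have e3 := pdx_periodic (pdt_periodic hper) t 0
  rw [zero_add] at e0 e1 e2 e3
  simp only [e0, e1, e2, e3]

theorem burgers_of_muDP (hu : ContDiff ℝ (⊤ : ℕ∞) u)
    (hper : ∀ t x, u (t, x + 1) = u (t, x)) {t : ℝ} (heq : ∀ x, muDP u t x = 0)
    (hmean : muMean u t = 0) (x : ℝ) : pdt u (t, x) + u (t, x) * pdx u (t, x) = 0 := by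
  have h1 := contDiff_pdx hu
  have ht := contDiff_pdt hu
  have hmt := muMean_pdt_eq_zero hu hper heq
  set F : ℝ → ℝ := fun y => pdt u (t, y) + u (t, y) * pdx u (t, y) with hF
  set F₁ : ℝ → ℝ := fun y => pdx (pdt u) (t, y) +
    (pdx u (t, y) * pdx u (t, y) + u (t, y) * pdx (pdx u) (t, y))
  have dF (y : ℝ) : HasDerivAt F (F₁ y) y :=
    (hasDerivAt_pdx ht t y).add ((hasDerivAt_pdx hu t y).mul (hasDerivAt_pdx h1 t y))
  have dF₁ (y : ℝ) : HasDerivAt F₁ 0 y := by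
    have d0 := hasDerivAt_pdx hu t y
    have d1 := hasDerivAt_pdx h1 t y
    have d2 := hasDerivAt_pdx (contDiff_pdx h1) t y
    have he := heq y
    unfold muDP at he
    rw [hmt, hmean] at he
    refine ((hasDerivAt_pdx (contDiff_pdx ht) t y).add
      ((d1.mul d1).add (d0.mul d2))).congr_deriv ?_
    linear_combination -he
  have hF10 : F 1 = F 0 := by
    have e0 := hper t 0
    have e1 := pdx_periodic hper t 0
    have e2 := pdt_periodic hper t 0
    rw [zero_add] at e0 e1 e2
    simp only [hF, e0, e1, e2]
  have hF₁0 : F₁ 0 = 0 :=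
    slope_eq_zero_of_hasDerivAt_const (fun y => eq_of_hasDerivAt_zero dF₁ y 0 ▸ dF y) hF10
  have hconst (y : ℝ) : F y = F x :=
    eq_of_hasDerivAt_zero (fun z => ((eq_of_hasDerivAt_zero dF₁ z 0).trans hF₁0) ▸ dF z) y x
  have hcont {v : ℝ × ℝ → ℝ} (hv : ContDiff ℝ (⊤ : ℕ∞) v) : Continuous fun y => v (t, y) :=
    hv.continuous.comp (Continuous.prodMk_right t)
  have hsq : ∫ y in (0 : ℝ)..1, u (t, y) * pdx u (t, y) = 0 := by
    have := intervalIntegral.integral_eq_sub_of_hasDerivAt (a := 0) (b := 1)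
      (f := fun y => u (t, y) ^ 2 / 2) (f' := fun y => u (t, y) * pdx u (t, y))
      (fun y _ => (((hasDerivAt_pdx hu t y).pow 2).div_const 2).congr_deriv (by push_cast; ring))
      (((hcont hu).mul (hcont h1)).intervalIntegrable 0 1)
    have e0 := hper t 0
    rw [zero_add] at e0
    rw [this, e0, sub_self]
  have hint : ∫ y in (0 : ℝ)..1, F y = 0 := by
    have hadd := intervalIntegral.integral_add (μ := volume) ((hcont ht).intervalIntegrable 0 1)
      (((hcont hu).mul (hcont h1)).intervalIntegrable 0 1)
    exact hadd.trans (by simpa [hsq, muMean] using hmt)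
  simpa [hconst] using hint

end MuDP

/-- Along the characteristic through `x₀`, a solution of the inviscid Burgers equation keeps its
value while its slope solves the Riccati equation `w' = -w²`. -/
theorem burgers_slope_along_characteristic {u : ℝ × ℝ → ℝ} (hu : ContDiff ℝ (⊤ : ℕ∞) u) {τ : ℝ}
    (hB : ∀ t ∈ Icc 0 τ, ∀ x, pdt u (t, x) + u (t, x) * pdx u (t, x) = 0) (x₀ : ℝ) :
    ∀ t ∈ Icc 0 τ,
      pdx u (t, x₀ + t * u (0, x₀)) * (1 + pdx u (0, x₀) * t) = pdx u (0, x₀) := by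
  have h1 := contDiff_pdx hu
  set c := u (0, x₀) with hc
  set m := pdx u (0, x₀) with hm
  have hline : Continuous fun s : ℝ => (s, x₀ + s * c) := by fun_prop
  have hcx : Continuous fun s => pdx u (s, x₀ + s * c) := h1.continuous.comp hline
  have hval : ∀ t ∈ Icc 0 τ, u (t, x₀ + t * c) - c = 0 := by
    refine eq_zero_of_hasDerivAt_mul_self (a := fun s => -pdx u (s, x₀ + s * c)) hcx.neg
      ((hu.continuous.comp hline).sub continuous_const) (fun t ht => ?_) (by simp [hc])
    refine ((hasDerivAt_along_line hu x₀ c t).sub_const c).congr_deriv ?_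
    linear_combination hB t (Ico_subset_Icc_self ht) (x₀ + t * c)
  have hderiv : ∀ t ∈ Icc 0 τ, ∀ x, pdt (pdx u) (t, x) =
      -(pdx u (t, x) * pdx u (t, x) + u (t, x) * pdx (pdx u) (t, x)) := by
    intro t ht x
    have hd := (hasDerivAt_pdx (contDiff_pdt hu) t x).add
      ((hasDerivAt_pdx hu t x).mul (hasDerivAt_pdx h1 t x))
    have h0 := hd.unique ((hasDerivAt_const x (0 : ℝ)).congr_of_eventuallyEq
      (Eventually.of_forall fun y => hB t ht y))
    rw [pdt_pdx_comm hu]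
    linear_combination h0
  have hslope : ∀ t ∈ Icc 0 τ, pdx u (t, x₀ + t * c) * (1 + m * t) - m = 0 := by
    refine eq_zero_of_hasDerivAt_mul_self (a := fun s => -pdx u (s, x₀ + s * c)) hcx.neg
      (by fun_prop) (fun t ht => ?_) (by simp [hm])
    have hlin : HasDerivAt (fun s => 1 + m * s) m t := by
      simpa using ((hasDerivAt_id t).const_mul m).const_add 1
    refine (((hasDerivAt_along_line h1 x₀ c t).mul hlin).sub_const m).congr_deriv ?_
    have ht' := Ico_subset_Icc_self ht
    rw [hderiv t ht']
    linear_combination -(1 + m * t) * pdx (pdx u) (t, x₀ + t * c) * hval t ht'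
  exact fun t ht => sub_eq_zero.mp (hslope t ht)

/-- A periodic function with nonnegative derivative on a period is constant. -/
theorem Function.Periodic.eq_of_deriv_nonneg {f : ℝ → ℝ} (hf : Function.Periodic f 1)
    (hd : Differentiable ℝ f) (h : ∀ x ∈ Icc (0 : ℝ) 1, 0 ≤ deriv f x) (x y : ℝ) : f x = f y := by
  have hmono : MonotoneOn f (Icc 0 1) :=
    monotoneOn_of_deriv_nonneg (convex_Icc 0 1) hd.continuous.continuousOn
      hd.differentiableOn fun x hx => h x (interior_subset hx)
  have h10 : f 1 = f 0 := by simpa using hf 0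
  have hzero (z : ℝ) : f z = f 0 := by
    obtain ⟨y, hy, hzy⟩ := hf.exists_mem_Ico₀ one_pos z
    have hy' := Ico_subset_Icc_self hy
    rw [hzy]
    refine le_antisymm ?_ (hmono (left_mem_Icc.2 zero_le_one) hy' hy.1)
    rw [← h10]
    exact hmono hy' (right_mem_Icc.2 zero_le_one) hy.2.le
  rw [hzero x, hzero y]

/-- a smooth spatially periodic solution of μDP with nonconstant zero-mean
initial data breaks down in finite time: with `M = min_{x ∈ [0,1]} u_x(0,x)` one has
`M < 0` and the lifespan `T` satisfies `T ≤ −1/M`. -/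
theorem muDP_blowup
    (T : EReal) (hT : 0 < T)
    (u : ℝ × ℝ → ℝ) (hu : ContDiff ℝ (⊤ : ℕ∞) u)
    (hper : ∀ t x, u (t, x + 1) = u (t, x))
    (heq : ∀ t x : ℝ, 0 ≤ t → (t : EReal) < T →
      muMean (pdt u) t - pdx (pdx (pdt u)) (t, x) + 3 * muMean u t * pdx u (t, x)
        - 3 * pdx u (t, x) * pdx (pdx u) (t, x) - u (t, x) * pdx (pdx (pdx u)) (t, x) = 0)
    (hmean0 : muMean u 0 = 0)
    (hnc : ∃ x y : ℝ, u (0, x) ≠ u (0, y)) :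
    sInf ((fun x => pdx u (0, x)) '' Set.Icc (0:ℝ) 1) < 0 ∧
      T ≤ ((-1 / sInf ((fun x => pdx u (0, x)) '' Set.Icc (0:ℝ) 1) : ℝ) : EReal) := by
  have h1 := contDiff_pdx hu
  set S := (fun x => pdx u (0, x)) '' Icc (0 : ℝ) 1
  have hcpt : IsCompact S :=
    isCompact_Icc.image (h1.continuous.comp (Continuous.prodMk_right 0))
  obtain ⟨x₀, -, hx₀⟩ : sInf S ∈ S :=
    hcpt.sInf_mem ((nonempty_Icc.2 zero_le_one).image _)
  have hneg : sInf S < 0 := by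
    by_contra! hM
    obtain ⟨x, y, hxy⟩ := hnc
    exact hxy (Function.Periodic.eq_of_deriv_nonneg (f := fun x => u (0, x)) (hper 0)
      (fun z => (hasDerivAt_pdx hu 0 z).differentiableAt)
      (fun z hz => hM.trans (csInf_le hcpt.bddBelow (mem_image_of_mem _ hz))) x y)
  refine ⟨hneg, not_lt.1 fun hlt => ?_⟩
  set τ := -1 / sInf S with hτ
  have hτ0 : 0 ≤ τ := div_nonneg_of_nonpos (by norm_num) hneg.le
  have heq' (t : ℝ) (ht : t ∈ Icc 0 τ) (x : ℝ) : muDP u t x = 0 :=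
    heq t x ht.1 (lt_of_le_of_lt (EReal.coe_le_coe_iff.2 ht.2) hlt)
  have hmean : ∀ t ∈ Icc 0 τ, muMean u t = 0 := by
    refine eq_zero_of_hasDerivAt_mul_self (a := fun _ => 0) continuous_const
      (continuous_iff_continuousAt.2 fun t => (hasDerivAt_muMean hu t).continuousAt)
      (fun t ht => ?_) hmean0
    rw [zero_mul, ← muMean_pdt_eq_zero hu hper (heq' t (Ico_subset_Icc_self ht))]
    exact hasDerivAt_muMean hu t
  have hend := burgers_slope_along_characteristic hu
    (fun t ht => burgers_of_muDP hu hper (heq' t ht) (hmean t ht)) x₀ τ (right_mem_Icc.2 hτ0)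
  have hx₀' : pdx u (0, x₀) = sInf S := hx₀
  rw [hx₀', hτ, mul_div_cancel₀ _ hneg.ne] at hend
  norm_num at hend
  exact hneg.ne hend.symm
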